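/- Asymptotically, 2^{n−1} · Ẽ_n / n! ∼ (4/π)^{n+1} as n → ∞; that is, the limit as n → ∞ of (2^{n−1} · Ẽ_n / n!) · (π/4)^{n+1} equals 1, where Ẽ_n is the number of alternating permutations of {1,…,n}. (This is the asymptotic expected number of alternating associative monomials in a commutator monomial of order n, averaged over permutations of the variables.) -/

import Mathlib

open scoped Classical

/-- Full plane binary trees with leaves labeled by natural numbers
(representing the variables `X_i`). -/
inductive BTree : Type where
  | leaf : ℕ → BTree
  | node : BTree → BTree → BTree

namespace BTree

/-- The list of leaf labels, from left to right. -/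
def leaves : BTree → List ℕ
  | leaf a => [a]
  | node l r => l.leaves ++ r.leaves

/-- The expansion set `W(T, ℓ)` of the commutator monomial modeled by `T`. -/
def words : BTree → Finset (List ℕ)
  | leaf a => {[a]}
  | node l r =>
      ((l.words ×ˢ r.words).image fun p => p.1 ++ p.2) ∪
      ((l.words ×ˢ r.words).image fun p => p.2 ++ p.1)

end BTree

/-- A word (list of labels) is alternating: consecutive entries differ, and no entry
lies strictly between its two neighbours. -/
def IsAlternating (w : List ℕ) : Prop :=
  (∀ i, i + 1 < w.length → w.getD i 0 ≠ w.getD (i + 1) 0) ∧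
  (∀ i, i + 2 < w.length →
    ¬ (w.getD i 0 < w.getD (i + 1) 0 ∧ w.getD (i + 1) 0 < w.getD (i + 2) 0) ∧
    ¬ (w.getD (i + 2) 0 < w.getD (i + 1) 0 ∧ w.getD (i + 1) 0 < w.getD i 0))

/-- A word is forward alternating: alternating, and it does not start with an ascent. -/
def IsForwardAlternating (w : List ℕ) : Prop :=
  IsAlternating w ∧ (w.length ≤ 1 ∨ w.getD 1 0 < w.getD 0 0)

/-- Number of alternating words in the expansion of `t`. -/
noncomputable def altCount (t : BTree) : ℕ :=
  (t.words.filter fun w => IsAlternating w).card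

/-- Number of forward alternating words in the expansion of `t`. -/
noncomputable def faltCount (t : BTree) : ℕ :=
  (t.words.filter fun w => IsForwardAlternating w).card

/-- `rAlt n` : the maximal number of alternating associative monomials in a commutator
monomial whose leaves are labeled bijectively by `{1, …, n}`. -/
noncomputable def rAlt (n : ℕ) : ℕ :=
  sSup {m | ∃ t : BTree, t.leaves.Perm (List.range' 1 n) ∧ m = altCount t}

/-- `rFAlt n` : the forward-alternating analogue of `rAlt n`. -/
noncomputable def rFAlt (n : ℕ) : ℕ :=
  sSup {m | ∃ t : BTree, t.leaves.Perm (List.range' 1 n) ∧ m = faltCount t}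

/-- The number of alternating permutations of `{1, …, n}` (denoted `Ẽ_n`). -/
noncomputable def altPerms (n : ℕ) : ℕ :=
  Nat.card {σ : Equiv.Perm (Fin n) // IsAlternating (List.ofFn fun i => (σ i : ℕ))}

/-- The number of forward alternating permutations of `{1, …, n}` (denoted `E_n`). -/
noncomputable def faltPerms (n : ℕ) : ℕ :=
  Nat.card {σ : Equiv.Perm (Fin n) // IsForwardAlternating (List.ofFn fun i => (σ i : ℕ))}

/-- A list is a zigzag if its consecutive comparisons alternate, starting with an ascent
(`b = true`) or a descent (`b = false`). -/
def Zigzag {α : Type*} [LT α] : Bool → List α → Prop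
  | _, [] => True
  | _, [_] => True
  | b, x :: y :: l => (if b then x < y else y < x) ∧ Zigzag (!b) (y :: l)

theorem zigzag_map {α β : Type*} [LinearOrder α] [LinearOrder β] {f : α → β} (hf : StrictMono f)
    (b : Bool) (l : List α) : Zigzag b (l.map f) ↔ Zigzag b l := by
  induction l generalizing b with
  | nil => rfl
  | cons x l ih =>
    cases l with
    | nil => rfl
    | cons y l =>
      have := ih (!b)
      simp only [List.map_cons] at this
      simp only [List.map_cons, Zigzag, this, hf.lt_iff_lt]

theorem zigzag_map_not {α β : Type*} [LinearOrder α] [LinearOrder β] {f : α → β}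
    (hf : StrictAnti f) (b : Bool) (l : List α) : Zigzag b (l.map f) ↔ Zigzag (!b) l := by
  induction l generalizing b with
  | nil => rfl
  | cons x l ih =>
    cases l with
    | nil => rfl
    | cons y l =>
      have := ih (!b)
      simp only [List.map_cons] at this
      simp only [List.map_cons, Zigzag, this, hf.lt_iff_gt]
      cases b <;> simp

theorem isAlternating_cons_cons_cons (x y z : ℕ) (l : List ℕ) :
    IsAlternating (x :: y :: z :: l) ↔
      x ≠ y ∧ ¬(x < y ∧ y < z) ∧ ¬(z < y ∧ y < x) ∧ IsAlternating (y :: z :: l) := by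
  constructor
  · rintro ⟨h1, h2⟩
    refine ⟨by simpa using h1 0, by simpa using (h2 0 (by simp)).1,
      by simpa using (h2 0 (by simp)).2, fun i hi => ?_, fun i hi => ?_⟩
    · simpa using h1 (i + 1) (by simpa using hi)
    · simpa using h2 (i + 1) (by simpa using hi)
  · rintro ⟨hxy, h1, h2, h3, h4⟩
    refine ⟨fun i hi => ?_, fun i hi => ?_⟩
    · cases i with
      | zero => simpa using hxy
      | succ i => simpa using h3 i (by simpa using hi)
    · cases i with
      | zero => exact ⟨by simpa using h1, by simpa using h2⟩
      | succ i => simpa using h4 i (by simpa using hi)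

theorem isAlternating_pair (x y : ℕ) : IsAlternating [x, y] ↔ x ≠ y := by
  constructor
  · rintro ⟨h, -⟩
    simpa using h 0
  · intro h
    refine ⟨fun i hi => ?_, fun i hi => ?_⟩
    · obtain rfl : i = 0 := by simpa using hi
      simpa using h
    · simp at hi

theorem isAlternating_iff_zigzag (x y : ℕ) (l : List ℕ) :
    IsAlternating (x :: y :: l) ↔ Zigzag true (x :: y :: l) ∨ Zigzag false (x :: y :: l) := by
  induction l generalizing x y with
  | nil => rw [isAlternating_pair]; simp [Zigzag, ← lt_or_lt_iff_ne]
  | cons z l ih =>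
    rw [isAlternating_cons_cons_cons, ih]
    simp only [Zigzag, if_true, Bool.not_true, Bool.not_false, Bool.false_eq_true, if_false]
    grind

theorem isAlternating_ofFn_iff {n : ℕ} (σ : Fin (n + 2) → ℕ) :
    IsAlternating (List.ofFn σ) ↔ Zigzag true (List.ofFn σ) ∨ Zigzag false (List.ofFn σ) := by
  simp only [List.ofFn_succ]
  exact isAlternating_iff_zigzag _ _ _

theorem not_zigzag_true_and_false {n : ℕ} (σ : Fin (n + 2) → ℕ) :
    ¬(Zigzag true (List.ofFn σ) ∧ Zigzag false (List.ofFn σ)) := by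
  simp only [List.ofFn_succ, Zigzag]
  grind

/-- The permutation of `Fin (n + 1)` with first value `p` whose remaining values are ordered
like those of `τ`. -/
def prependPerm {n : ℕ} (p : Fin (n + 1)) (τ : Equiv.Perm (Fin n)) : Equiv.Perm (Fin (n + 1)) :=
  (finSuccEquiv' 0).trans ((Equiv.optionCongr τ).trans (finSuccEquiv' p).symm)

@[simp]
theorem prependPerm_zero {n : ℕ} (p : Fin (n + 1)) (τ : Equiv.Perm (Fin n)) :
    prependPerm p τ 0 = p := by
  simp [prependPerm]

@[simp]
theorem prependPerm_succ {n : ℕ} (p : Fin (n + 1)) (τ : Equiv.Perm (Fin n)) (i : Fin n) :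
    prependPerm p τ i.succ = p.succAbove (τ i) := by
  have : finSuccEquiv' (0 : Fin (n + 1)) i.succ = some i := by
    rw [← Fin.succAbove_zero, finSuccEquiv'_succAbove]
  simp [prependPerm, this]

theorem prependPerm_bijective (n : ℕ) :
    Function.Bijective fun x : Fin (n + 1) × Equiv.Perm (Fin n) => prependPerm x.1 x.2 := by
  rw [Fintype.bijective_iff_injective_and_card]
  constructor
  · rintro ⟨p, τ⟩ ⟨q, τ'⟩ h
    simp only at h
    obtain rfl : p = q := by simpa using congrArg (fun σ => σ 0) h
    refine Prod.ext rfl (Equiv.ext fun i => ?_)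
    simpa using congrArg (fun σ => σ i.succ) h
  · simp [Fintype.card_perm, Nat.factorial_succ]

theorem ofFn_prependPerm {n : ℕ} (p : Fin (n + 1)) (τ : Equiv.Perm (Fin n)) :
    List.ofFn (prependPerm p τ) = p :: (List.ofFn τ).map p.succAbove := by
  simp [List.ofFn_succ, List.map_ofFn, Function.comp_def]

theorem zigzag_false_prependPerm {n : ℕ} (p : Fin (n + 2)) (τ : Equiv.Perm (Fin (n + 1))) :
    Zigzag false (List.ofFn (prependPerm p τ)) ↔
      (τ 0).castSucc < p ∧ Zigzag true (List.ofFn τ) := by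
  rw [ofFn_prependPerm, ← zigzag_map (Fin.strictMono_succAbove p) true (List.ofFn τ),
    List.ofFn_succ, List.map_cons]
  simp [Zigzag, Fin.succAbove_lt_iff_castSucc_lt]

/-- The number of zigzag permutations of `Fin (n + 1)` with first value `p`. -/
noncomputable def zigzagCount (b : Bool) (n : ℕ) (p : Fin (n + 1)) : ℕ :=
  Nat.card {σ : Equiv.Perm (Fin (n + 1)) // σ 0 = p ∧ Zigzag b (List.ofFn σ)}

theorem card_fiberwise {n : ℕ} (P : Equiv.Perm (Fin (n + 1)) → Prop) (s : Fin (n + 1) → Prop)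
    [DecidablePred s] :
    Nat.card {σ : Equiv.Perm (Fin (n + 1)) // s (σ 0) ∧ P σ} =
      ∑ q with s q, Nat.card {σ : Equiv.Perm (Fin (n + 1)) // σ 0 = q ∧ P σ} := by
  simp only [Nat.card_eq_fintype_card, Fintype.card_subtype]
  rw [Finset.card_eq_sum_card_fiberwise (f := fun σ => σ 0) (t := Finset.univ.filter s)]
  · refine Finset.sum_congr rfl fun q hq => ?_
    congr 1
    ext σ
    simp only [Finset.mem_filter, Finset.mem_univ, true_and] at hq ⊢
    grind
  · intro σ hσ
    simp at hσ ⊢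
    exact hσ.1

theorem zigzagCount_false_succ (n : ℕ) (p : Fin (n + 2)) :
    zigzagCount false (n + 1) p = ∑ q with Fin.castSucc q < p, zigzagCount true n q := by
  unfold zigzagCount
  rw [← card_fiberwise (fun τ => Zigzag true (List.ofFn τ)) (fun q => q.castSucc < p)]
  symm
  refine Nat.card_eq_of_bijective
    (fun τ => ⟨prependPerm p τ.1, prependPerm_zero _ _,
      (zigzag_false_prependPerm p τ.1).2 τ.2⟩) ⟨?_, ?_⟩
  · rintro ⟨τ, _⟩ ⟨τ', _⟩ h
    simp only [Subtype.mk.injEq] at h ⊢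
    exact congrArg Prod.snd ((prependPerm_bijective (n + 1)).1 (a₁ := (p, τ)) (a₂ := (p, τ')) h)
  · rintro ⟨σ, h0, hσ⟩
    obtain ⟨⟨q, τ⟩, rfl⟩ := (prependPerm_bijective (n + 1)).2 σ
    obtain rfl : q = p := by simpa using h0
    exact ⟨⟨τ, (zigzag_false_prependPerm q τ).1 hσ⟩, rfl⟩

theorem zigzag_trans_revPerm {n : ℕ} (b : Bool) (σ : Equiv.Perm (Fin n)) :
    Zigzag b (List.ofFn (σ.trans Fin.revPerm)) ↔ Zigzag (!b) (List.ofFn σ) := by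
  rw [← zigzag_map_not Fin.rev_strictAnti, List.map_ofFn]
  rfl

theorem zigzagCount_true (n : ℕ) (p : Fin (n + 1)) :
    zigzagCount true n p = zigzagCount false n p.rev := by
  refine Nat.card_congr ((Equiv.mulLeft Fin.revPerm).subtypeEquiv fun σ => ?_)
  change _ ↔ Fin.rev (σ 0) = p.rev ∧ Zigzag false (List.ofFn (σ.trans Fin.revPerm))
  rw [zigzag_trans_revPerm, Fin.rev_inj, Bool.not_false]

/-- The Entringer numbers. -/
def entringer : ℕ → ℕ → ℕ
  | 0, _ => 1
  | n + 1, p => ∑ q ∈ Finset.range p, entringer n (n - q)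

theorem zigzagCount_false (n : ℕ) (p : Fin (n + 1)) :
    zigzagCount false n p = entringer n p := by
  induction n with
  | zero =>
    rw [zigzagCount, entringer, Nat.card_eq_one_iff_unique]
    have : Subsingleton (Fin (0 + 1)) := inferInstanceAs (Subsingleton (Fin 1))
    exact ⟨inferInstance, ⟨1, Subsingleton.elim _ _, by simp [Zigzag]⟩⟩
  | succ n ih =>
    rw [zigzagCount_false_succ, entringer]
    simp only [zigzagCount_true, ih, Fin.val_rev, Nat.add_sub_add_right]
    refine Finset.sum_bij (fun q _ => q.1) ?_ ?_ ?_ ?_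
    · intro q hq
      simpa [Fin.lt_def] using hq
    · intro q _ q' _ h
      exact Fin.ext h
    · intro q hq
      have hq' := Finset.mem_range.1 hq
      exact ⟨⟨q, by omega⟩, by simpa [Fin.lt_def] using hq', rfl⟩
    · intro q _
      rfl

theorem card_zigzag_false (n : ℕ) :
    Nat.card {σ : Equiv.Perm (Fin (n + 1)) // Zigzag false (List.ofFn σ)} =
      entringer (n + 1) (n + 1) := by
  have h := card_fiberwise (n := n) (fun σ => Zigzag false (List.ofFn σ)) (fun _ => True)
  simp only [true_and, Finset.filter_true] at h
  rw [h, entringer, ← Finset.sum_range_reflect, Finset.sum_range]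
  refine Finset.sum_congr rfl fun q _ => ?_
  have := q.2
  rw [show n - (n + 1 - 1 - q) = q by omega]
  exact zigzagCount_false n q

theorem card_zigzag_true (n : ℕ) :
    Nat.card {σ : Equiv.Perm (Fin n) // Zigzag true (List.ofFn σ)} =
      Nat.card {σ : Equiv.Perm (Fin n) // Zigzag false (List.ofFn σ)} := by
  refine Nat.card_congr ((Equiv.mulLeft Fin.revPerm).subtypeEquiv fun σ => ?_)
  exact (zigzag_trans_revPerm false σ).symm

theorem altPerms_eq (n : ℕ) : altPerms (n + 2) = 2 * entringer (n + 2) (n + 2) := by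
  have key (b : Bool) (σ : Equiv.Perm (Fin (n + 2))) :
      Zigzag b (List.ofFn fun i => (σ i : ℕ)) ↔ Zigzag b (List.ofFn σ) := by
    rw [← zigzag_map Fin.val_strictMono, List.map_ofFn]
    rfl
  have h (σ : Equiv.Perm (Fin (n + 2))) := isAlternating_ofFn_iff fun i => (σ i : ℕ)
  have h' (σ : Equiv.Perm (Fin (n + 2))) := not_zigzag_true_and_false fun i => (σ i : ℕ)
  simp only [key] at h h'
  rw [altPerms, two_mul]
  simp only [h]
  nth_rw 1 [← card_zigzag_false, ← card_zigzag_true]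
  rw [← card_zigzag_false]
  simp only [Nat.card_eq_fintype_card, Fintype.card_subtype, Finset.filter_or]
  exact Finset.card_union_of_disjoint (Finset.disjoint_filter.2 fun σ _ ht hf => h' σ ⟨ht, hf⟩)

open Polynomial in
/-- The polynomial whose coefficients in the Bernstein basis are the Entringer numbers divided
by `n!`. -/
noncomputable def entringerPoly (n : ℕ) : ℝ[X] :=
  ∑ p ∈ Finset.range (n + 1), C ((entringer n p : ℝ) / n.factorial) * bernsteinPolynomial ℝ n p

theorem bernstein_sum_derivative (n : ℕ) (c : ℕ → ℝ) :
    Polynomial.derivative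
        (∑ p ∈ Finset.range (n + 2), Polynomial.C (c p) * bernsteinPolynomial ℝ (n + 1) p) =
      ∑ p ∈ Finset.range (n + 1),
        Polynomial.C ((n + 1) * (c (p + 1) - c p)) * bernsteinPolynomial ℝ n p := by
  have h1 := Finset.sum_range_succ' (fun p => Polynomial.C (c p) * bernsteinPolynomial ℝ n p)
    (n + 1)
  rw [Finset.sum_range_succ, bernsteinPolynomial.eq_zero_of_lt ℝ (Nat.lt_succ_self n), mul_zero,
    add_zero] at h1
  rw [Finset.sum_range_succ', map_add, map_sum]
  simp only [Polynomial.derivative_C_mul, bernsteinPolynomial.derivative_succ,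
    bernsteinPolynomial.derivative_zero, Nat.add_sub_cancel, map_mul, map_sub, mul_assoc, sub_mul,
    mul_sub, Finset.sum_sub_distrib, ← Finset.mul_sum]
  simp only [mul_left_comm _ (((n + 1 : ℕ) : Polynomial ℝ)), ← Finset.mul_sum, h1]
  simp
  ring

theorem entringerPoly_derivative (n : ℕ) :
    (entringerPoly (n + 1)).derivative = (entringerPoly n).comp (1 - Polynomial.X) := by
  rw [entringerPoly, bernstein_sum_derivative n fun p =>
      (entringer (n + 1) p : ℝ) / (n + 1).factorial,
    entringerPoly, Polynomial.sum_comp, ← Finset.sum_range_reflect]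
  refine Finset.sum_congr rfl fun p hp => ?_
  have hp : p ≤ n := Nat.lt_succ_iff.1 (Finset.mem_range.1 hp)
  rw [Polynomial.mul_comp, Polynomial.C_comp, bernsteinPolynomial.flip _ _ _ hp,
    show n + 1 - 1 - p = n - p by omega]
  congr 2
  have hrec : entringer (n + 1) (n - p + 1) = entringer (n + 1) (n - p) + entringer n p := by
    rw [entringer, entringer, Finset.sum_range_succ, show n - (n - p) = p by omega]
  rw [hrec, Nat.factorial_succ]
  push_cast
  field_simp
  ring

theorem entringerPoly_eval_zero (n : ℕ) : (entringerPoly (n + 1)).eval 0 = 0 := by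
  simp [entringerPoly, Polynomial.eval_finsetSum, bernsteinPolynomial.eval_at_0, entringer]

theorem entringerPoly_eval_one (n : ℕ) :
    (entringerPoly n).eval 1 = (entringer n n : ℝ) / n.factorial := by
  simp [entringerPoly, Polynomial.eval_finsetSum, bernsteinPolynomial.eval_at_1]

theorem entringerPoly_one : entringerPoly 1 = Polynomial.X := by
  simp [entringerPoly, Finset.sum_range_succ, entringer, bernsteinPolynomial]

open Real

/-- The frequency of the `k`-th eigenfunction `sin ((2 * k + 1) * π * x / 2)`. -/
noncomputable def quarterFreq (k : ℕ) : ℝ := (2 * k + 1) * π / 2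

theorem quarterFreq_pos (k : ℕ) : 0 < quarterFreq k := by
  unfold quarterFreq; positivity

theorem one_le_quarterFreq (k : ℕ) : 1 ≤ quarterFreq k := by
  have := pi_gt_three
  have := mul_nonneg (Nat.cast_nonneg (α := ℝ) k) pi_pos.le
  unfold quarterFreq; linarith

theorem cos_quarterFreq (k : ℕ) : cos (quarterFreq k) = 0 := by
  rw [cos_eq_zero_iff]
  exact ⟨k, by simp [quarterFreq]⟩

theorem sin_quarterFreq (k : ℕ) : sin (quarterFreq k) = (-1) ^ k := by
  rw [show quarterFreq k = k * π + π / 2 by unfold quarterFreq; ring, sin_add_pi_div_two,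
    cos_nat_mul_pi]

theorem sin_quarterFreq_mul_one_sub (k : ℕ) (x : ℝ) :
    sin (quarterFreq k * (1 - x)) = (-1) ^ k * cos (quarterFreq k * x) := by
  rw [mul_sub, mul_one, sin_sub, cos_quarterFreq, sin_quarterFreq, zero_mul, sub_zero]

theorem cos_quarterFreq_mul_one_sub (k : ℕ) (x : ℝ) :
    cos (quarterFreq k * (1 - x)) = (-1) ^ k * sin (quarterFreq k * x) := by
  rw [mul_sub, mul_one, cos_sub, cos_quarterFreq, sin_quarterFreq, zero_mul, zero_add]

/-- The terms of the sine series of `entringerPoly n`. -/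
noncomputable def sineSeriesTerm (n k : ℕ) (x : ℝ) : ℝ :=
  2 * ((-1) ^ k / quarterFreq k) ^ n / quarterFreq k * sin (quarterFreq k * x)

theorem hasDerivAt_sineSeriesTerm (n k : ℕ) (x : ℝ) :
    HasDerivAt (sineSeriesTerm (n + 1) k) (sineSeriesTerm n k (1 - x)) x := by
  have h := (((hasDerivAt_id x).const_mul (quarterFreq k)).sin).const_mul
    (2 * ((-1) ^ k / quarterFreq k) ^ (n + 1) / quarterFreq k)
  refine h.congr_deriv ?_
  have := (quarterFreq_pos k).ne'
  rw [sineSeriesTerm, sin_quarterFreq_mul_one_sub, pow_succ]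
  simp only [id]
  field_simp

theorem summable_two_div_quarterFreq_sq : Summable fun k => 2 / quarterFreq k ^ 2 := by
  have h := ((summable_nat_add_iff 1).2 (summable_one_div_nat_pow.2 one_lt_two)).mul_left 2
  refine h.of_nonneg_of_le (fun k => by positivity) fun k => ?_
  rw [mul_one_div]
  have : ((k + 1 : ℕ) : ℝ) ≤ quarterFreq k := by
    have := pi_gt_three
    have := mul_nonneg (Nat.cast_nonneg (α := ℝ) k) (sub_nonneg.2 pi_gt_three.le)
    unfold quarterFreq; push_cast; linarith
  gcongr

theorem abs_sineSeriesTerm_le (n k : ℕ) (x : ℝ) : |sineSeriesTerm (n + 1) k x| ≤ 2 / quarterFreq k ^ 2 := by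
  have h0 := quarterFreq_pos k
  have h1 : (1 / quarterFreq k) ^ n ≤ 1 :=
    pow_le_one₀ (by positivity) ((div_le_one h0).2 (one_le_quarterFreq k))
  have h2 := abs_sin_le_one (quarterFreq k * x)
  simp only [sineSeriesTerm, abs_mul, abs_div, abs_pow, abs_neg, abs_one, one_pow, abs_two,
    abs_of_pos h0]
  calc 2 * (1 / quarterFreq k) ^ (n + 1) / quarterFreq k * |sin (quarterFreq k * x)|
      = 2 / quarterFreq k ^ 2 * ((1 / quarterFreq k) ^ n * |sin (quarterFreq k * x)|) := by
        rw [pow_succ]; field_simp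
    _ ≤ 2 / quarterFreq k ^ 2 * (1 * 1) := by gcongr
    _ = 2 / quarterFreq k ^ 2 := by ring

theorem summable_sineSeriesTerm (n : ℕ) (x : ℝ) : Summable fun k => sineSeriesTerm (n + 1) k x :=
  summable_two_div_quarterFreq_sq.of_norm_bounded fun k => abs_sineSeriesTerm_le n k x

theorem bernoulli_two_eval (x : ℝ) :
    ((Polynomial.bernoulli 2).map (algebraMap ℚ ℝ)).eval x = x ^ 2 - x + 1 / 6 := by
  rw [Polynomial.bernoulli_def]
  simp [Finset.sum_range_succ, bernoulli_eq_bernoulli'_of_ne_one]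
  ring

theorem hasSum_cos_div_sq {x : ℝ} (hx : x ∈ Set.Icc (0 : ℝ) 1) :
    HasSum (fun n : ℕ => 1 / (n : ℝ) ^ 2 * cos (2 * π * n * x)) (π ^ 2 * (x ^ 2 - x + 1 / 6)) := by
  convert! hasSum_one_div_nat_pow_mul_cos one_ne_zero hx using 1
  rw [mul_one, bernoulli_two_eval]
  simp only [Nat.factorial]
  push_cast
  ring

theorem hasSum_cos_div_odd_sq {x : ℝ} (hx : x ∈ Set.Icc (0 : ℝ) (1 / 2)) :
    HasSum (fun k : ℕ => 1 / (2 * k + 1 : ℝ) ^ 2 * cos (2 * π * (2 * k + 1) * x))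
      (π ^ 2 * (1 / 8 - x / 2)) := by
  have h := hasSum_cos_div_sq (x := x) ⟨hx.1, hx.2.trans (by norm_num)⟩
  have he := (hasSum_cos_div_sq (x := 2 * x)
    ⟨by linarith [hx.1], by linarith [hx.2]⟩).mul_left (1 / 4)
  have he' : HasSum (fun k : ℕ => 1 / ((2 * k : ℕ) : ℝ) ^ 2 * cos (2 * π * (2 * k : ℕ) * x))
      (1 / 4 * (π ^ 2 * ((2 * x) ^ 2 - 2 * x + 1 / 6))) := by
    convert! he using 2 with k
    push_cast
    rw [show 2 * π * (2 * k) * x = 2 * π * k * (2 * x) by ring]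
    ring
  obtain ⟨s, ho⟩ : Summable fun k : ℕ =>
      1 / ((2 * k + 1 : ℕ) : ℝ) ^ 2 * cos (2 * π * (2 * k + 1 : ℕ) * x) :=
    h.summable.comp_injective (i := fun k : ℕ => 2 * k + 1) fun a b hab => by simpa using hab
  have hs := (HasSum.even_add_odd (f := fun n : ℕ => 1 / (n : ℝ) ^ 2 * cos (2 * π * n * x))
    he' ho).unique h
  obtain rfl : s = π ^ 2 * (1 / 8 - x / 2) := by linarith
  simpa only [Nat.cast_add, Nat.cast_mul, Nat.cast_ofNat, Nat.cast_one] using ho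

theorem hasSum_sineSeriesTerm_one {x : ℝ} (hx : x ∈ Set.Icc (0 : ℝ) 1) :
    HasSum (fun k => sineSeriesTerm 1 k x) x := by
  have h := (hasSum_cos_div_odd_sq (x := (1 - x) / 4)
    ⟨by linarith [hx.2], by linarith [hx.1]⟩).mul_left (8 / π ^ 2)
  have hpi := pi_pos.ne'
  convert! h using 1
  · ext k
    rw [show 2 * π * (2 * k + 1) * ((1 - x) / 4) = quarterFreq k * (1 - x) by
      unfold quarterFreq; ring, cos_quarterFreq_mul_one_sub, sineSeriesTerm, quarterFreq]
    have : (2 * k + 1 : ℝ) ≠ 0 := by positivity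
    field_simp
    norm_num [mul_comm]
  · field_simp
    ring

theorem hasSum_sineSeriesTerm (n : ℕ) {x : ℝ} (hx : x ∈ Set.Icc (0 : ℝ) 1) :
    HasSum (fun k => sineSeriesTerm (n + 1) k x) ((entringerPoly (n + 1)).eval x) := by
  induction n generalizing x with
  | zero => simpa [entringerPoly_one] using hasSum_sineSeriesTerm_one hx
  | succ n ih =>
    have hd (y : ℝ) : HasDerivAt
        (fun z => (∑' k, sineSeriesTerm (n + 2) k z) - (entringerPoly (n + 2)).eval z)
        ((∑' k, sineSeriesTerm (n + 1) k (1 - y)) - (entringerPoly (n + 1)).eval (1 - y)) y := by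
      refine (hasDerivAt_tsum summable_two_div_quarterFreq_sq
        (fun k => hasDerivAt_sineSeriesTerm (n + 1) k) (fun k y => abs_sineSeriesTerm_le n k (1 - y))
        (summable_sineSeriesTerm (n + 1) 0) y).sub ?_
      have := (entringerPoly (n + 2)).hasDerivAt y
      rwa [entringerPoly_derivative, Polynomial.eval_comp, Polynomial.eval_sub,
        Polynomial.eval_one, Polynomial.eval_X] at this
    have hc := constant_of_has_deriv_right_zero
      (fun y _ => (hd y).continuousAt.continuousWithinAt)
      (fun y hy => by
        have := hd y
        rw [(ih ⟨sub_nonneg.2 hy.2.le, sub_le_self _ hy.1⟩).tsum_eq, sub_self] at this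
        exact this.hasDerivWithinAt) x hx
    rw [entringerPoly_eval_zero, sub_zero] at hc
    rw [← sub_eq_zero.1 (hc.trans (by simp [sineSeriesTerm]))]
    exact (summable_sineSeriesTerm (n + 1) x).hasSum

theorem hasSum_entringer (n : ℕ) :
    HasSum (fun k : ℕ => ((-1) ^ k / (2 * k + 1 : ℝ)) ^ (n + 2))
      ((entringer (n + 1) (n + 1) : ℝ) / (n + 1).factorial * (π / 2) ^ (n + 2) / 2) := by
  have h := ((hasSum_sineSeriesTerm n (Set.right_mem_Icc.2 zero_le_one)).mul_right
    ((π / 2) ^ (n + 2))).div_const 2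
  rw [entringerPoly_eval_one] at h
  convert! h using 2 with k
  have hpi := pi_pos.ne'
  have hk : (2 * k + 1 : ℝ) ≠ 0 := by positivity
  have : (-1 : ℝ) ^ k / (2 * k + 1) = (-1) ^ k / quarterFreq k * (π / 2) := by
    rw [quarterFreq]; field_simp
  rw [sineSeriesTerm, mul_one, sin_quarterFreq, this, mul_pow, pow_succ _ (n + 1)]
  ring

theorem tendsto_tsum_odd_pow :
    Filter.Tendsto (fun n : ℕ => ∑' k : ℕ, ((-1) ^ k / (2 * k + 1 : ℝ)) ^ (n + 2))
      Filter.atTop (nhds 1) := by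
  have hsum : Summable fun k : ℕ => (1 / (2 * k + 1 : ℝ)) ^ 2 := by
    refine ((hasSum_cos_div_odd_sq (x := 0) (by norm_num)).summable).congr fun k => ?_
    simp
  have hlt (k : ℕ) : |(-1) ^ k / (2 * k + 1 : ℝ)| = 1 / (2 * k + 1) := by
    rw [abs_div, abs_pow, abs_neg, abs_one, one_pow, abs_of_pos (by positivity)]
  have h := tendsto_tsum_of_dominated_convergence (𝓕 := Filter.atTop)
    (f := fun (n : ℕ) (k : ℕ) => ((-1) ^ k / (2 * k + 1 : ℝ)) ^ (n + 2))
    (g := fun k => if k = 0 then (1 : ℝ) else 0) hsum ?_ ?_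
  · simpa using h
  · intro k
    rcases Nat.eq_zero_or_pos k with rfl | hk
    · simp
    · simp only [hk.ne', if_false]
      refine (tendsto_pow_atTop_nhds_zero_of_abs_lt_one ?_).comp (Filter.tendsto_add_atTop_nat 2)
      rw [hlt, div_lt_one (by positivity)]
      have : (0 : ℝ) < k := by exact_mod_cast hk
      linarith
  · refine Filter.Eventually.of_forall fun n k => ?_
    rw [norm_pow, Real.norm_eq_abs, hlt]
    refine pow_le_pow_of_le_one (by positivity) ?_ (by omega)
    rw [div_le_one (by positivity)]
    have : (0 : ℝ) ≤ k := k.cast_nonneg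
    linarith

/-- Asymptotically `2^{n-1} Ẽ_n / n! ∼ (4/π)^{n+1}`: the expected number of alternating
monomials in a commutator monomial of order `n`, averaged over permutations of the
variables. -/
theorem average_asymptotics :
    Filter.Tendsto
      (fun n : ℕ =>
        ((2 : ℝ) ^ (n - 1) * (altPerms n : ℝ) / (Nat.factorial n)) *
          (Real.pi / 4) ^ (n + 1))
      Filter.atTop (nhds 1) := by
  rw [← Filter.tendsto_add_atTop_iff_nat 2]
  refine (tendsto_tsum_odd_pow.comp (Filter.tendsto_add_atTop_nat 1)).congr fun n => ?_
  simp only [Function.comp_apply]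
  rw [(hasSum_entringer (n + 1)).tsum_eq, altPerms_eq, Nat.add_sub_cancel (n + 1) 1,
    show π / 2 = 2 * (π / 4) by ring, mul_pow]
  push_cast
  ring
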